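/- arXiv:2005.11390 — 4 statements merged into one kernel-verified Lean document; each statement's English description precedes it below -/
import Mathlib

section
/- There exists a continuous function φ : ℝ → ℝ with φ(0) = 0 such that: (i) φ is locally Lipschitz on ℝ \ {0} (in particular φ is (1/2)-little Hölder on a neighborhood of every point of ℝ \ {0}); (ii) lim_{x→0} |φ(x)|/|x|^{1/2} = 0; and (iii) for every compact neighborhood U of 0, φ is NOT (1/2)-little Hölder on U, i.e. it is not true that lim_{r→0} sup{ |φ(b) − φ(a)|/|b − a|^{1/2} : a, b ∈ U, 0 < |b − a| < r } = 0. -/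
open Filter Topology

/-- `x ↦ x * sin (1 / x)` is continuous, with value `0` at the origin. -/
theorem continuous_mul_sin_inv : Continuous fun x : ℝ => x * Real.sin x⁻¹ := by
  rw [continuous_iff_continuousAt]
  intro x
  rcases eq_or_ne x 0 with rfl | hx
  · have h : Tendsto (fun x : ℝ => x * Real.sin x⁻¹) (𝓝 0) (𝓝 0) := by
      refine squeeze_zero_norm (a := fun x : ℝ => |x|) (fun x => ?_) ?_
      · rw [Real.norm_eq_abs, abs_mul]
        exact mul_le_of_le_one_right (abs_nonneg x) (Real.abs_sin_le_one _)
      · simpa using (continuous_abs.tendsto (0 : ℝ))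
    simpa [ContinuousAt] using h
  · exact continuousAt_id.mul (Real.continuous_sin.continuousAt.comp (continuousAt_inv₀ hx))

/-- Near every nonzero point, `x ↦ x * sin (1 / x)` is Lipschitz. -/
theorem exists_lipschitzOnWith_mul_sin_inv {x : ℝ} (hx : x ≠ 0) :
    ∃ (K : NNReal) (s : Set ℝ), s ∈ 𝓝 x ∧ LipschitzOnWith K (fun x : ℝ => x * Real.sin x⁻¹) s := by
  have h : ContDiffAt ℝ 1 (fun x : ℝ => x * Real.sin x⁻¹) x :=
    contDiffAt_id.mul (Real.contDiff_sin.contDiffAt.comp x (contDiffAt_inv ℝ hx))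
  exact h.exists_lipschitzOnWith

theorem tendsto_abs_mul_sin_inv_div_sqrt :
    Tendsto (fun x : ℝ => |x * Real.sin x⁻¹| / Real.sqrt |x|) (𝓝[≠] (0 : ℝ)) (𝓝 0) := by
  have h : Tendsto (fun x : ℝ => Real.sqrt |x|) (𝓝[≠] (0 : ℝ)) (𝓝 0) := by
    have hc : Continuous fun x : ℝ => Real.sqrt |x| := by fun_prop
    simpa using (hc.tendsto 0).mono_left nhdsWithin_le_nhds
  refine squeeze_zero (fun x => by positivity) (fun x => ?_) h
  calc |x * Real.sin x⁻¹| / Real.sqrt |x| ≤ |x| / Real.sqrt |x| := by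
        refine div_le_div_of_nonneg_right ?_ (Real.sqrt_nonneg _)
        rw [abs_mul]
        exact mul_le_of_le_one_right (abs_nonneg x) (Real.abs_sin_le_one _)
    _ = Real.sqrt |x| := Real.div_sqrt

/-- The points `(t + π / 2)⁻¹` and `(t - π / 2)⁻¹` with `t` a large multiple of `2 * π` are
consecutive extrema of `x * sin (1 / x)`, between which its increment exceeds the square root of
their distance. -/
theorem sqrt_lt_abs_mul_sin_inv_sub {n : ℕ} (hn : 1 ≤ n) {a b : ℝ}
    (ha : a = (n * (2 * Real.pi) + Real.pi / 2)⁻¹) (hb : b = (n * (2 * Real.pi) - Real.pi / 2)⁻¹) :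
    0 < |b - a| ∧ Real.sqrt |b - a| < |b * Real.sin b⁻¹ - a * Real.sin a⁻¹| := by
  have hpi := Real.pi_pos
  have hn' : (1 : ℝ) ≤ n := by exact_mod_cast hn
  have hp : 0 < n * (2 * Real.pi) + Real.pi / 2 := by positivity
  have hm : 0 < n * (2 * Real.pi) - Real.pi / 2 := by nlinarith
  have ha0 : 0 < a := ha ▸ inv_pos.2 hp
  have hb0 : 0 < b := hb ▸ inv_pos.2 hm
  have hsa : Real.sin a⁻¹ = 1 := by
    rw [ha, inv_inv, add_comm, Real.sin_add_nat_mul_two_pi, Real.sin_pi_div_two]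
  have hsb : Real.sin b⁻¹ = -1 := by
    rw [hb, inv_inv, sub_eq_neg_add, Real.sin_add_nat_mul_two_pi, Real.sin_neg,
      Real.sin_pi_div_two]
  have hab : b - a = Real.pi * (a * b) := by
    rw [ha, hb, inv_sub_inv hm.ne' hp.ne', ← mul_inv, div_eq_mul_inv, mul_comm (_ + _) (_ - _)]
    ring
  have hpos : 0 < b - a := by rw [hab]; positivity
  rw [abs_of_pos hpos, hsa, hsb, abs_of_neg (by linarith)]
  refine ⟨hpos, (Real.sqrt_lt' (by linarith)).2 ?_⟩
  have := mul_lt_mul_of_pos_right Real.pi_lt_four (mul_pos ha0 hb0)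
  nlinarith [sq_nonneg (a - b)]

/-- There exists a continuous `φ : ℝ → ℝ` with `φ 0 = 0` such that:
(i) `φ` is locally Lipschitz on `ℝ \ {0}`;
(ii) `|φ x| / |x|^(1/2) → 0` as `x → 0`;
(iii) for every compact neighborhood `U` of `0`, `φ` is not `(1/2)`-little Hölder on `U`. -/
theorem statement0 :
    ∃ φ : ℝ → ℝ, Continuous φ ∧ φ 0 = 0 ∧
      (∀ x : ℝ, x ≠ 0 → ∃ (K : NNReal) (s : Set ℝ), s ∈ 𝓝 x ∧ LipschitzOnWith K φ s) ∧
      Tendsto (fun x : ℝ => |φ x| / Real.sqrt |x|) (𝓝[≠] (0 : ℝ)) (𝓝 0) ∧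
      (∀ U : Set ℝ, IsCompact U → U ∈ 𝓝 (0 : ℝ) →
        ¬ (∀ ε > (0 : ℝ), ∃ r > (0 : ℝ), ∀ a ∈ U, ∀ b ∈ U,
            0 < |b - a| → |b - a| < r → |φ b - φ a| ≤ ε * Real.sqrt |b - a|)) := by
  refine ⟨fun x => x * Real.sin x⁻¹, continuous_mul_sin_inv, by simp,
    fun x hx => exists_lipschitzOnWith_mul_sin_inv hx, tendsto_abs_mul_sin_inv_div_sqrt, ?_⟩
  intro U _ hU h
  obtain ⟨r, hr, h⟩ := h 1 one_pos
  have ht : Tendsto (fun n : ℕ => (n : ℝ) * (2 * Real.pi)) atTop atTop :=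
    tendsto_natCast_atTop_atTop.atTop_mul_const Real.two_pi_pos
  have hA : Tendsto (fun n : ℕ => (n * (2 * Real.pi) + Real.pi / 2)⁻¹) atTop (𝓝 0) :=
    (tendsto_atTop_add_const_right _ (Real.pi / 2) ht).inv_tendsto_atTop
  have hB : Tendsto (fun n : ℕ => (n * (2 * Real.pi) - Real.pi / 2)⁻¹) atTop (𝓝 0) :=
    (tendsto_atTop_add_const_right _ (-(Real.pi / 2)) ht).inv_tendsto_atTop
  have hd := (hB.sub hA).abs
  rw [sub_zero, abs_zero] at hd
  obtain ⟨n, haU, hbU, hlt, hn⟩ := ((hA.eventually_mem hU).and ((hB.eventually_mem hU).and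
    ((hd.eventually_lt_const hr).and (eventually_ge_atTop 1)))).exists
  obtain ⟨hpos, hgt⟩ := sqrt_lt_abs_mul_sin_inv_sub hn rfl rfl
  have hle := h _ haU _ hbU hpos hlt
  rw [one_mul] at hle
  exact hgt.not_ge hle
end

section
/- Assume 0 ∈ U and φ(0) = 0, and that there exists C > 0 with |φ(w)| ≤ C‖w‖ for all w ∈ U. Then there exists C' > 0, depending only on C, m, h and the matrices B^(1),…,B^(h), such that for every j = 2,…,m and every C^1 curve γ : [0,T] → U with γ(0) = 0 and γ'(t) = D^φ_j|_{γ(t)} for all t ∈ [0,T], one has ‖γ(t)‖ ≤ C'·t and |φ(γ(t))| ≤ C'·t for every t ∈ [0,T]. -/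
open MeasureTheory Filter Topology

namespace Step2

/-- The underlying space of the step-2 Carnot group `G = ℝ^m × ℝ^h`. -/
abbrev G (m h : ℕ) := (Fin m → ℝ) × (Fin h → ℝ)

variable {m h : ℕ}

/-- Group product `(x,y)·(x',y') = (x+x', y+y' - (1/2)⟨Bx,x'⟩)`. -/
noncomputable def gmul (B : Fin h → Matrix (Fin m) (Fin m) ℝ) (p q : G m h) : G m h :=
  (p.1 + q.1, fun i => p.2 i + q.2 i - (1 / 2) * ∑ j, ∑ k, B i j k * p.1 k * q.1 j)

/-- Group inverse `g⁻¹ = -g`. -/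
def ginv (p : G m h) : G m h := (-p.1, -p.2)

/-- Homogeneous norm `‖(x,y)‖ = Σ|x_j| + Σ|y_i|^(1/2)`. -/
noncomputable def hnorm (p : G m h) : ℝ :=
  (∑ j, |p.1 j|) + ∑ i, Real.sqrt |p.2 i|

/-- Homogeneous (quasi-)distance `d(p,q) = ‖p⁻¹·q‖`. -/
noncomputable def gdist (B : Fin h → Matrix (Fin m) (Fin m) ℝ) (p q : G m h) : ℝ :=
  hnorm (gmul B (ginv p) q)

/-- Euclidean distance on `G`. -/
noncomputable def eDist (p q : G m h) : ℝ :=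
  Real.sqrt ((∑ j, (p.1 j - q.1 j) ^ 2) + ∑ i, (p.2 i - q.2 i) ^ 2)

/-- The subgroup `W = {x_1 = 0}`. -/
def Wset (m h : ℕ) [NeZero m] : Set (G m h) := {p | p.1 0 = 0}

/-- `U` is (relatively) open in `W`. -/
def RelOpen (m h : ℕ) [NeZero m] (U : Set (G m h)) : Prop :=
  ∃ O : Set (G m h), IsOpen O ∧ U = O ∩ Wset m h

/-- The graphing map `Φ(w) = (φ(w),0,…,0) ∈ L`. -/
noncomputable def Phi [NeZero m] (φ : G m h → ℝ) (w : G m h) : G m h :=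
  ((fun j => if j = 0 then φ w else 0), 0)

/-- Horizontal coordinate vector `e_{x_j}`. -/
def eH (m h : ℕ) (j : Fin m) : G m h := ((fun j' => if j' = j then 1 else 0), 0)

/-- Vertical coordinate vector `e_{y_i}`. -/
def eV (m h : ℕ) (i : Fin h) : G m h := (0, fun i' => if i' = i then 1 else 0)

/-- The projected vector field `D^φ_j` (for `j ≠ 0`, i.e. `j = 2,…,m` in 1-based indexing):
`D^φ_j|_w = ∂_{x_j} - Σ_i ( b^(i)_{j1} φ(w) + (1/2) Σ_{k≥2} x_k b^(i)_{jk} ) ∂_{y_i}`. -/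
noncomputable def Dvec [NeZero m] (B : Fin h → Matrix (Fin m) (Fin m) ℝ)
    (φ : G m h → ℝ) (j : Fin m) (w : G m h) : G m h :=
  ((fun j' => if j' = j then 1 else 0),
   fun i => -(B i j 0 * φ w
      + (1 / 2) * ∑ k ∈ Finset.univ.erase (0 : Fin m), w.1 k * B i j k))

/-- `D^φφ = ω` in the broad* sense on `U`. -/
def IsBroadStar [NeZero m] (B : Fin h → Matrix (Fin m) (Fin m) ℝ) (U : Set (G m h))
    (φ : G m h → ℝ) (ω : G m h → Fin m → ℝ) : Prop :=
  ∀ a₀ ∈ U, ∃ δ₁ δ₂ : ℝ, 0 < δ₂ ∧ δ₂ < δ₁ ∧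
    ∀ j : Fin m, j ≠ 0 → ∃ E : G m h → ℝ → G m h,
      ∀ a, a ∈ U → eDist a a₀ ≤ δ₂ →
        (∀ t ∈ Set.Icc (-δ₂) δ₂, E a t ∈ U ∧ eDist (E a t) a₀ ≤ δ₁) ∧
        E a 0 = a ∧
        (∀ t ∈ Set.Icc (-δ₂) δ₂,
          HasDerivWithinAt (E a) (Dvec B φ j (E a t)) (Set.Icc (-δ₂) δ₂) t) ∧
        (∀ t ∈ Set.Icc (-δ₂) δ₂, φ (E a t) - φ a = ∫ s in (0:ℝ)..t, ω (E a s) j)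

/-- `φ` is vertically broad* Hölder on `U`. -/
def VertHolder (m h : ℕ) [NeZero m] (U : Set (G m h)) (φ : G m h → ℝ) : Prop :=
  ∀ a₀ ∈ U, ∃ U' : Set (G m h), RelOpen m h U' ∧ a₀ ∈ U' ∧
    IsCompact (closure U') ∧ closure U' ⊆ U ∧
    ∀ i : Fin h, ∀ ε > (0:ℝ), ∃ ρ > (0:ℝ), ∀ p ∈ U', ∀ q ∈ U',
      p.1 = q.1 → (∀ i' : Fin h, i' ≠ i → p.2 i' = q.2 i') →
      0 < |p.2 i - q.2 i| → |p.2 i - q.2 i| ≤ ρ →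
      |φ p - φ q| ≤ ε * Real.sqrt |p.2 i - q.2 i|

/-- The translated point `Φ(a)⁻¹·a⁻¹·b·Φ(a)`. -/
noncomputable def shiftQ [NeZero m] (B : Fin h → Matrix (Fin m) (Fin m) ℝ)
    (φ : G m h → ℝ) (a b : G m h) : G m h :=
  gmul B (gmul B (gmul B (ginv (Phi φ a)) (ginv a)) b) (Phi φ a)

/-- `φ` is intrinsically differentiable at `a₀` with intrinsic gradient `grad`. -/
def IDAt [NeZero m] (B : Fin h → Matrix (Fin m) (Fin m) ℝ) (U : Set (G m h))
    (φ : G m h → ℝ) (a₀ : G m h) (grad : Fin m → ℝ) : Prop :=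
  ∀ ε > (0:ℝ), ∃ r > (0:ℝ), ∀ b ∈ U, 0 < gdist B a₀ b → gdist B a₀ b < r →
    |φ b - φ a₀ - ∑ j ∈ Finset.univ.erase (0 : Fin m), grad j * (b.1 j - a₀.1 j)|
      ≤ ε * hnorm (shiftQ B φ a₀ b)

/-- `φ` is uniformly intrinsically differentiable at `a₀` with intrinsic gradient `grad`. -/
def UIDAt [NeZero m] (B : Fin h → Matrix (Fin m) (Fin m) ℝ) (U : Set (G m h))
    (φ : G m h → ℝ) (a₀ : G m h) (grad : Fin m → ℝ) : Prop :=
  ∀ ε > (0:ℝ), ∃ r > (0:ℝ), ∀ a ∈ U, ∀ b ∈ U,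
    gdist B a₀ a < r → gdist B a₀ b < r → a ≠ b →
    |φ b - φ a - ∑ j ∈ Finset.univ.erase (0 : Fin m), grad j * (b.1 j - a.1 j)|
      ≤ ε * hnorm (shiftQ B φ a b)

/-- Projection onto `L` in the splitting `G = W·L`. -/
def piL (m h : ℕ) [NeZero m] (g : G m h) : G m h :=
  ((fun j => if j = 0 then g.1 0 else 0), 0)

/-- Projection onto `W` in the splitting `G = W·L`. -/
noncomputable def piW [NeZero m] (B : Fin h → Matrix (Fin m) (Fin m) ℝ) (g : G m h) : G m h :=
  ((fun j => if j = 0 then 0 else g.1 j),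
   fun i => g.2 i + (1 / 2) * g.1 0 * ∑ k ∈ Finset.univ.erase (0 : Fin m), B i 0 k * g.1 k)

/-- Coordinates `ℝ^(m-1) × ℝ^h → W ⊆ G`. -/
def emb (m h : ℕ) (u : (Fin (m - 1) → ℝ) × (Fin h → ℝ)) : G m h :=
  ((fun j => if hj : (j : ℕ) = 0 then 0
      else u.1 ⟨(j : ℕ) - 1, by have := j.isLt; omega⟩), u.2)

/-- The Lebesgue measure on `W`, as a measure on `G`. -/
noncomputable def muW (m h : ℕ) : Measure (G m h) :=
  Measure.map (emb m h) volume

end Step2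

namespace Step2

variable {m h : ℕ}

theorem continuous_hnorm : Continuous (hnorm : G m h → ℝ) := by
  unfold hnorm
  fun_prop

/-- An integral curve of `D^φ_j` through `0` has horizontal part `t ↦ t e_j`. -/
theorem integralCurve_fst [NeZero m] {B : Fin h → Matrix (Fin m) (Fin m) ℝ} {φ : G m h → ℝ}
    {j : Fin m} {T : ℝ} {γ : ℝ → G m h} (h0 : γ 0 = 0)
    (hγ : ∀ t ∈ Set.Icc (0:ℝ) T, HasDerivWithinAt γ (Dvec B φ j (γ t)) (Set.Icc (0:ℝ) T) t)
    {t : ℝ} (ht : t ∈ Set.Icc (0:ℝ) T) (k : Fin m) :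
    (γ t).1 k = if k = j then t else 0 := by
  have hd : ∀ s ∈ Set.Icc (0:ℝ) T,
      HasDerivWithinAt (fun s => (γ s).1 k - s * (if k = j then 1 else 0)) 0
        (Set.Icc (0:ℝ) T) s := fun s hs => by
    have h1 := (hasDerivWithinAt_pi.1 (hγ s hs).fst) k
    have h2 := (hasDerivWithinAt_id s (Set.Icc (0:ℝ) T)).mul_const
      (if k = j then (1:ℝ) else 0)
    exact (h1.sub h2).congr_deriv (by simp [Dvec])
  have hle := (convex_Icc (0:ℝ) T).norm_image_sub_le_of_norm_hasDerivWithin_le (C := 0) hd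
    (by simp) ⟨le_rfl, ht.1.trans ht.2⟩ ht
  have h1 : (γ t).1 k - t * (if k = j then 1 else 0) = 0 := by
    simpa [h0] using hle
  rw [sub_eq_zero.1 h1]
  split_ifs <;> simp

/-- Along `t ↦ t e_j` only the `φ`-term of `D^φ_j` survives, by skew-symmetry. -/
theorem Dvec_snd_of_fst [NeZero m] {B : Fin h → Matrix (Fin m) (Fin m) ℝ}
    (hskew : ∀ i, (B i).transpose = - B i) (φ : G m h → ℝ) {j : Fin m} {w : G m h} {t : ℝ}
    (hw : ∀ k, w.1 k = if k = j then t else 0) (i : Fin h) :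
    (Dvec B φ j w).2 i = -(B i j 0 * φ w) := by
  have hjj : B i j j = 0 := by
    have := congrFun (congrFun (hskew i) j) j
    simp only [Matrix.transpose_apply, Matrix.neg_apply] at this
    linarith
  have hsum : ∑ k ∈ Finset.univ.erase (0 : Fin m), w.1 k * B i j k = 0 :=
    Finset.sum_eq_zero fun k _ => by
      rw [hw]
      split_ifs with hk
      · rw [hk, hjj, mul_zero]
      · rw [zero_mul]
  simp only [Dvec, hsum, mul_zero, add_zero]

/-- If `0 ∈ U`, `φ(0) = 0` and `|φ(w)| ≤ C‖w‖` on `U`, then there is `C' > 0`,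
depending only on `C`, `m`, `h` and the matrices `B`, such that every integral curve
`γ : [0,T] → U` of `D^φ_j` starting at `0` satisfies `‖γ(t)‖ ≤ C'·t` and `|φ(γ(t))| ≤ C'·t`. -/
theorem statement1 (m h : ℕ) [NeZero m] (hm : 2 ≤ m) (hh : 1 ≤ h)
    (B : Fin h → Matrix (Fin m) (Fin m) ℝ)
    (hskew : ∀ i, (B i).transpose = - B i) (hBli : LinearIndependent ℝ B)
    (C : ℝ) (hC : 0 < C) :
    ∃ C' > (0:ℝ), ∀ (U : Set (G m h)) (φ : G m h → ℝ),
      U ⊆ Wset m h → RelOpen m h U → ContinuousOn φ U →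
      (0 : G m h) ∈ U → φ 0 = 0 →
      (∀ w ∈ U, |φ w| ≤ C * hnorm w) →
      ∀ j : Fin m, j ≠ 0 → ∀ T : ℝ, 0 ≤ T → ∀ γ : ℝ → G m h,
        γ 0 = 0 →
        (∀ t ∈ Set.Icc (0:ℝ) T, γ t ∈ U) →
        (∀ t ∈ Set.Icc (0:ℝ) T, HasDerivWithinAt γ (Dvec B φ j (γ t)) (Set.Icc (0:ℝ) T) t) →
        ∀ t ∈ Set.Icc (0:ℝ) T, hnorm (γ t) ≤ C' * t ∧ |φ (γ t)| ≤ C' * t := by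
  set β : ℝ := ∑ i, ∑ j, |B i j 0| with hβ
  have hβ0 : 0 ≤ β := by positivity
  have hBβ : ∀ i j, |B i j 0| ≤ β := fun i j =>
    (Finset.single_le_sum (f := fun j => |B i j 0|) (fun _ _ => abs_nonneg _)
      (Finset.mem_univ j)).trans
      (Finset.single_le_sum (f := fun i => ∑ j, |B i j 0|)
        (fun _ _ => Finset.sum_nonneg fun _ _ => abs_nonneg _) (Finset.mem_univ i))
  set K : ℝ := 2 + (h:ℝ) ^ 2 * (β * C) with hK
  have hK0 : 0 < K := by positivity
  refine ⟨(1 + C) * K, by positivity, ?_⟩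
  intro U φ _ _ _ _ _ hφ j _ T _ γ h0 hU hγ t ht
  have hsub : Set.Icc 0 t ⊆ Set.Icc 0 T := Set.Icc_subset_Icc_right ht.2
  obtain ⟨s, hs, hmax⟩ := isCompact_Icc.exists_isMaxOn (Set.nonempty_Icc.2 ht.1)
    (continuous_hnorm.comp_continuousOn
      (fun r hr => (hγ r (hsub hr)).continuousWithinAt.mono hsub) :
      ContinuousOn (fun r => hnorm (γ r)) (Set.Icc 0 t))
  set S := hnorm (γ s) with hS
  have hS0 : 0 ≤ S := by
    rw [hS, hnorm]
    positivity
  have hy : ∀ i, |(γ s).2 i| ≤ β * C * S * t := fun i => by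
    have hle := (convex_Icc (0:ℝ) t).norm_image_sub_le_of_norm_hasDerivWithin_le
      (f := fun r => (γ r).2 i) (C := β * C * S)
      (fun r hr => (hasDerivWithinAt_pi.1 ((hγ r (hsub hr)).mono hsub).snd) i)
      (fun r hr => by
        rw [Dvec_snd_of_fst hskew φ (integralCurve_fst h0 hγ (hsub hr)), norm_neg, norm_mul,
          mul_assoc]
        exact mul_le_mul (hBβ i j)
          ((hφ _ (hU r (hsub hr))).trans (mul_le_mul_of_nonneg_left (hmax hr) hC.le))
          (norm_nonneg _) hβ0)
      ⟨le_rfl, ht.1⟩ hs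
    have hs0 : |s| ≤ t := by rw [abs_of_nonneg hs.1]; exact hs.2
    simp only [h0, Prod.snd_zero, Pi.zero_apply, sub_zero, Real.norm_eq_abs] at hle
    exact hle.trans (mul_le_mul_of_nonneg_left hs0 (by positivity))
  have hx : ∑ k, |(γ s).1 k| = s := by
    simp [integralCurve_fst h0 hγ (hsub hs), apply_ite abs, abs_of_nonneg hs.1]
  have hSle : S ≤ t + h * Real.sqrt (β * C * S * t) := by
    have hsum := Finset.sum_le_sum fun i (_ : i ∈ Finset.univ) => Real.sqrt_le_sqrt (hy i)
    rw [Finset.sum_const, Finset.card_univ, Fintype.card_fin, nsmul_eq_mul] at hsum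
    calc S = s + ∑ i, √|(γ s).2 i| := by rw [hS, hnorm, hx]
      _ ≤ _ := add_le_add hs.2 hsum
  have ht0 := ht.1
  have hAMGM : h * Real.sqrt (β * C * S * t) ≤ S / 2 + (h:ℝ) ^ 2 * (β * C) * t / 2 := by
    rw [← Real.sqrt_sq (Nat.cast_nonneg (α := ℝ) h), ← Real.sqrt_mul (by positivity),
      Real.sqrt_sq (Nat.cast_nonneg (α := ℝ) h)]
    refine Real.sqrt_le_iff.2 ⟨by positivity, ?_⟩
    nlinarith [sq_nonneg (S / 2 - (h:ℝ) ^ 2 * (β * C) * t / 2)]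
  have hSK : S ≤ K * t := by
    rw [hK]
    linarith
  have hn : hnorm (γ t) ≤ K * t := (hmax ⟨ht.1, le_rfl⟩).trans hSK
  have hKt : 0 ≤ K * t := by positivity
  have hC1 := mul_le_mul_of_nonneg_left hn hC.le
  have hC2 := mul_nonneg hC.le hKt
  exact ⟨by linarith, (hφ _ (hU t ht)).trans (by linarith)⟩

end Step2
end

section
/- Let L > 0 and assume φ is intrinsically L-Lipschitz on U. Then there exists C' > 0, depending only on L, m, h and the matrices B^(1),…,B^(h), such that: (i) for every j = 2,…,m and every C^1 curve γ : [0,T] → U with γ'(t) = D^φ_j|_{γ(t)}, one has ‖Φ(γ(s))^{-1}·γ(s)^{-1}·γ(t)·Φ(γ(s))‖ ≤ C'|t − s| and |φ(γ(t)) − φ(γ(s))| ≤ C'|t − s| for all 0 ≤ s < t ≤ T; and (ii) for every i = 1,…,h and every affine segment γ(t) = w + t e_{y_i} in the y_i-direction contained in U (an integral curve of ∂_{y_i}), one has |φ(γ(t)) − φ(γ(s))| ≤ C'|t − s|^{1/2} for all s < t in its interval of definition. -/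
open MeasureTheory Filter Topology

namespace Step2

lemma dotProduct_mulVec_skew {n : ℕ} {A : Matrix (Fin n) (Fin n) ℝ} (hA : A.transpose = -A)
    (x y : Fin n → ℝ) : x ⬝ᵥ A.mulVec y = -(y ⬝ᵥ A.mulVec x) := by
  rw [Matrix.dotProduct_mulVec, ← Matrix.mulVec_transpose, hA, Matrix.neg_mulVec,
    neg_dotProduct, dotProduct_comm]

lemma skew_diag {n : ℕ} {A : Matrix (Fin n) (Fin n) ℝ} (hA : A.transpose = -A) (j : Fin n) :
    A j j = 0 := by
  have := congrFun (congrFun hA j) j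
  simp only [Matrix.transpose_apply, Matrix.neg_apply] at this
  linarith

section

variable {m h : ℕ} (B : Fin h → Matrix (Fin m) (Fin m) ℝ)

lemma gmul_snd (p q : G m h) (i : Fin h) :
    (gmul B p q).2 i = p.2 i + q.2 i - 1 / 2 * (q.1 ⬝ᵥ (B i).mulVec p.1) := by
  simp only [gmul, dotProduct, Matrix.mulVec, Finset.mul_sum]
  congr 1
  exact Finset.sum_congr rfl fun j _ => Finset.sum_congr rfl fun k _ => by ring

variable [NeZero m]

lemma Phi_fst (φ : G m h → ℝ) (a : G m h) : (Phi φ a).1 = φ a • Pi.single 0 1 := by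
  ext j
  by_cases hj : j = 0 <;> simp [Phi, hj]

lemma shiftQ_fst (φ : G m h → ℝ) (a b : G m h) : (shiftQ B φ a b).1 = b.1 - a.1 := by
  simp only [shiftQ, gmul, ginv]
  abel

variable {B}

lemma shiftQ_snd (hskew : ∀ i, (B i).transpose = -B i)
    (φ : G m h → ℝ) (a b : G m h) (i : Fin h) :
    (shiftQ B φ a b).2 i = b.2 i - a.2 i + 1 / 2 * (b.1 ⬝ᵥ (B i).mulVec a.1)
      + φ a * ((b.1 - a.1) ⬝ᵥ (B i).mulVec (Pi.single 0 1)) := by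
  have h₁ : (Pi.single 0 1 : Fin m → ℝ) ⬝ᵥ (B i).mulVec (Pi.single 0 1) = 0 := by
    simp [skew_diag (hskew i)]
  have h₂ := dotProduct_mulVec_skew (hskew i) (Pi.single 0 1) a.1
  have h₃ := dotProduct_mulVec_skew (hskew i) (Pi.single 0 1) b.1
  have hf (p q : G m h) : (gmul B p q).1 = p.1 + q.1 := rfl
  have hi (p : G m h) : (ginv p).1 = -p.1 := rfl
  have hi' (p : G m h) : (ginv p).2 i = -p.2 i := rfl
  have hp (p : G m h) : (Phi φ p).2 i = 0 := rfl
  simp only [shiftQ, gmul_snd, hf, hi, hi', hp, Phi_fst, Matrix.mulVec_add, Matrix.mulVec_neg,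
    Matrix.mulVec_smul, dotProduct_add, dotProduct_neg, dotProduct_smul,
    neg_dotProduct, smul_dotProduct, sub_dotProduct, smul_eq_mul, h₁, h₂, h₃]
  ring

lemma piW_graph (hskew : ∀ i, (B i).transpose = -B i)
    {φ : G m h → ℝ} {a b : G m h} (ha : a ∈ Wset m h) (hb : b ∈ Wset m h) :
    piW B (gmul B (ginv (gmul B a (Phi φ a))) (gmul B b (Phi φ b))) = shiftQ B φ a b := by
  have ha' : a.1 0 = 0 := ha
  have hb' : b.1 0 = 0 := hb
  refine Prod.ext ?_ ?_
  · rw [shiftQ_fst]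
    ext j
    by_cases hj : j = 0
    · simp [piW, hj, ha', hb']
    · simp [piW, hj, gmul, ginv, Phi]
      ring
  · ext i
    have herase (x : Fin m → ℝ) : ∑ k ∈ Finset.univ.erase (0 : Fin m), B i 0 k * x k
        = (Pi.single 0 1 : Fin m → ℝ) ⬝ᵥ (B i).mulVec x := by
      rw [single_dotProduct, one_mul, Matrix.mulVec, dotProduct,
        ← Finset.add_sum_erase _ _ (Finset.mem_univ (0 : Fin m)), skew_diag (hskew i)]
      simp
    have h₁ : (Pi.single 0 1 : Fin m → ℝ) ⬝ᵥ (B i).mulVec (Pi.single 0 1) = 0 := by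
      simp [skew_diag (hskew i)]
    have h₂ := dotProduct_mulVec_skew (hskew i) (Pi.single 0 1) a.1
    have h₃ := dotProduct_mulVec_skew (hskew i) (Pi.single 0 1) b.1
    have hf (p q : G m h) : (gmul B p q).1 = p.1 + q.1 := rfl
    have hi (p : G m h) : (ginv p).1 = -p.1 := rfl
    have hi' (p : G m h) : (ginv p).2 i = -p.2 i := rfl
    have hp (p : G m h) : (Phi φ p).2 i = 0 := rfl
    rw [shiftQ_snd hskew]
    simp only [piW, herase]
    simp only [gmul_snd, hf, hi, hi', hp, Phi_fst, Matrix.mulVec_add, Matrix.mulVec_neg,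
      Matrix.mulVec_smul, dotProduct_add, dotProduct_neg, dotProduct_smul, add_dotProduct,
      smul_dotProduct, sub_dotProduct, smul_eq_mul, h₁, h₂, h₃,
      Pi.add_apply, Pi.neg_apply, Pi.smul_apply, Pi.single_eq_same, ha', hb']
    ring

lemma hnorm_piL_graph {φ : G m h → ℝ} {a b : G m h} (ha : a ∈ Wset m h) (hb : b ∈ Wset m h) :
    hnorm (piL m h (gmul B (ginv (gmul B a (Phi φ a))) (gmul B b (Phi φ b)))) = |φ b - φ a| := by
  have ha' : a.1 0 = 0 := ha
  have hb' : b.1 0 = 0 := hb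
  have hsum (c : ℝ) : ∑ j : Fin m, |if j = 0 then c else 0| = |c| := by
    simp [apply_ite abs]
  simp only [hnorm, piL, hsum]
  simp [gmul, ginv, Phi, ha', hb', neg_add_eq_sub]

/-- Along an integral curve of `D^φ_j`, the vertical part of the translated point solves
`Y' = -b_{j1} (φ(γ(τ)) - φ(γ(s)))`. -/
lemma hasDerivWithinAt_shiftQ_snd (hskew : ∀ i, (B i).transpose = -B i)
    {φ : G m h → ℝ} {j : Fin m} {S : Set ℝ} {γ : ℝ → G m h}
    {s τ : ℝ} (hx : (γ τ).1 = (γ s).1 + (τ - s) • Pi.single j 1) (hW : (γ s).1 0 = 0)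
    (hγ : HasDerivWithinAt γ (Dvec B φ j (γ τ)) S τ) (i : Fin h) :
    HasDerivWithinAt (fun r => (shiftQ B φ (γ s) (γ r)).2 i)
      (-(B i j 0 * (φ (γ τ) - φ (γ s)))) S τ := by
  have hfst := (ContinuousLinearMap.fst ℝ (Fin m → ℝ) (Fin h → ℝ)).hasFDerivAt
    |>.comp_hasDerivWithinAt τ hγ
  have hsnd := (ContinuousLinearMap.snd ℝ (Fin m → ℝ) (Fin h → ℝ)).hasFDerivAt
    |>.comp_hasDerivWithinAt τ hγ
  have hdot (v : Fin m → ℝ) : HasDerivWithinAt (fun r => (γ r).1 ⬝ᵥ v) (v j) S τ := by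
    have := HasDerivWithinAt.fun_sum (u := Finset.univ)
      fun k _ => ((hasDerivWithinAt_pi.1 hfst k).mul_const (v k))
    simpa [Dvec, dotProduct] using this
  have herase : ∑ k ∈ Finset.univ.erase (0 : Fin m), (γ τ).1 k * B i j k
      = (B i).mulVec (γ s).1 j := by
    rw [Matrix.mulVec, dotProduct]
    rw [← Finset.add_sum_erase _ _ (Finset.mem_univ (0 : Fin m)), hW, mul_zero, zero_add]
    refine Finset.sum_congr rfl fun k _ => ?_
    by_cases hk : k = j
    · simp [hk, skew_diag (hskew i)]
    · simp [hx, hk, mul_comm]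
  simp only [shiftQ_snd hskew, sub_dotProduct]
  have hy := hasDerivWithinAt_pi.1 hsnd i
  refine (((hy.sub_const ((γ s).2 i)).add ((hdot ((B i).mulVec (γ s).1)).const_mul (1 / 2))).add
    (((hdot ((B i).mulVec (Pi.single 0 1))).sub_const _).const_mul (φ (γ s)))).congr_deriv ?_
  simp only [Dvec, herase, ContinuousLinearMap.coe_snd']
  simp only [Matrix.mulVec_single_one, Matrix.col_apply]
  ring

end

/-- If `γ` is an integral curve of `D^φ_j`, its horizontal part moves linearly. -/
lemma fst_integralCurve {m h : ℕ} [NeZero m] {B : Fin h → Matrix (Fin m) (Fin m) ℝ}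
    {φ : G m h → ℝ} {j : Fin m} {T : ℝ} {γ : ℝ → G m h}
    (hγ : ∀ t ∈ Set.Icc (0 : ℝ) T, HasDerivWithinAt γ (Dvec B φ j (γ t)) (Set.Icc 0 T) t)
    {s τ : ℝ} (hs : s ∈ Set.Icc 0 T) (hτ : τ ∈ Set.Icc 0 T) :
    (γ τ).1 = (γ s).1 + (τ - s) • Pi.single j 1 := by
  have hd : ∀ t ∈ Set.Icc (0 : ℝ) T, HasDerivWithinAt
      (fun r => (γ r).1 - r • (Pi.single j 1 : Fin m → ℝ)) 0 (Set.Icc 0 T) t := by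
    intro t ht
    have hfst := (ContinuousLinearMap.fst ℝ (Fin m → ℝ) (Fin h → ℝ)).hasFDerivAt
      |>.comp_hasDerivWithinAt t (hγ t ht)
    refine (hfst.sub ((hasDerivWithinAt_id t _).smul_const
      (Pi.single j 1 : Fin m → ℝ))).congr_deriv ?_
    ext k
    by_cases hk : k = j <;> simp [Dvec, hk]
  have h0 := (convex_Icc (0 : ℝ) T).norm_image_sub_le_of_norm_hasDerivWithin_le (C := 0) hd
    (by simp) hs hτ
  rw [zero_mul, norm_le_zero_iff, sub_eq_zero, sub_eq_iff_eq_add] at h0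
  rw [h0, sub_smul]
  abel

lemma le_of_le_add_mul_sqrt {L d K M F : ℝ} (hd : 0 ≤ d) (hM : 0 ≤ M) (hF : 0 ≤ F)
    (h : F ≤ L * (d + K * √(M * F * d))) : F ≤ (2 * L + L ^ 2 * K ^ 2 * M) * d := by
  have hsq : √(M * F * d) = √F * √(M * d) := by
    rw [← Real.sqrt_mul hF]
    congr 1
    ring
  rw [hsq] at h
  have h₁ := Real.sq_sqrt hF
  have h₂ := Real.sq_sqrt (mul_nonneg hM hd)
  have h₃ := sq_nonneg (√F - L * K * √(M * d))
  rw [sub_sq, mul_pow, h₁, h₂] at h₃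
  linarith

/-- If `φ` is intrinsically `L`-Lipschitz on `U`, then there is `C' > 0`,
depending only on `L`, `m`, `h`, `B`, such that (i) along every integral curve of `D^φ_j`
one has `‖Φ(γ(s))⁻¹·γ(s)⁻¹·γ(t)·Φ(γ(s))‖ ≤ C'|t-s|` and `|φ(γ(t))-φ(γ(s))| ≤ C'|t-s|`,
and (ii) along vertical segments `|φ(γ(t))-φ(γ(s))| ≤ C'|t-s|^(1/2)`. -/
theorem statement2 (m h : ℕ) [NeZero m] (hm : 2 ≤ m) (hh : 1 ≤ h)
    (B : Fin h → Matrix (Fin m) (Fin m) ℝ)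
    (hskew : ∀ i, (B i).transpose = - B i) (hBli : LinearIndependent ℝ B)
    (L : ℝ) (hL : 0 < L) :
    ∃ C' > (0:ℝ), ∀ (U : Set (G m h)) (φ : G m h → ℝ),
      U ⊆ Wset m h → RelOpen m h U → ContinuousOn φ U →
      -- intrinsic `L`-Lipschitz continuity of `φ` on `U`
      (∀ a ∈ U, ∀ b ∈ U,
        hnorm (piL m h (gmul B (ginv (gmul B a (Phi φ a))) (gmul B b (Phi φ b))))
          ≤ L * hnorm (piW B (gmul B (ginv (gmul B a (Phi φ a))) (gmul B b (Phi φ b))))) →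
      -- (i) behavior along integral curves of the horizontal projected fields
      ((∀ j : Fin m, j ≠ 0 → ∀ T : ℝ, ∀ γ : ℝ → G m h,
          (∀ t ∈ Set.Icc (0:ℝ) T, γ t ∈ U) →
          (∀ t ∈ Set.Icc (0:ℝ) T,
            HasDerivWithinAt γ (Dvec B φ j (γ t)) (Set.Icc (0:ℝ) T) t) →
          ∀ s t : ℝ, 0 ≤ s → s < t → t ≤ T →
            hnorm (shiftQ B φ (γ s) (γ t)) ≤ C' * |t - s| ∧
            |φ (γ t) - φ (γ s)| ≤ C' * |t - s|) ∧
        -- (ii) behavior along vertical segments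
        (∀ i : Fin h, ∀ w : G m h, ∀ s t : ℝ, s < t →
          (∀ r ∈ Set.Icc s t, w + r • eV m h i ∈ U) →
          |φ (w + t • eV m h i) - φ (w + s • eV m h i)| ≤ C' * Real.sqrt (t - s))) := by
  obtain ⟨M, hM0, hM⟩ : ∃ M : ℝ, 0 ≤ M ∧ ∀ i j k, |B i j k| ≤ M :=
    ⟨∑ i, ∑ j, ∑ k, |B i j k|, by positivity, fun i j k =>
      ((Finset.single_le_sum (f := fun k => |B i j k|) (fun _ _ => abs_nonneg _)
        (Finset.mem_univ k)).trans (Finset.single_le_sum (f := fun j => ∑ k, |B i j k|)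
        (fun _ _ => by positivity) (Finset.mem_univ j))).trans
        (Finset.single_le_sum (f := fun i => ∑ j, ∑ k, |B i j k|)
        (fun _ _ => by positivity) (Finset.mem_univ i))⟩
  obtain ⟨C, hC⟩ : ∃ C : ℝ, C = 2 * L + L ^ 2 * (h : ℝ) ^ 2 * M := ⟨_, rfl⟩
  have hC0 : 0 ≤ C := by rw [hC]; positivity
  refine ⟨L + C + (1 + h * √(M * C)), by positivity, ?_⟩
  intro U φ hUW _ hφ hLip
  have hLip' : ∀ a ∈ U, ∀ b ∈ U, |φ b - φ a| ≤ L * hnorm (shiftQ B φ a b) := by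
    intro a ha b hb
    have := hLip a ha b hb
    rwa [hnorm_piL_graph (hUW ha) (hUW hb), piW_graph hskew (hUW ha) (hUW hb)] at this
  refine ⟨?_, ?_⟩
  · intro j _ T γ hγU hγ s t hs hst htT
    have hsub : Set.Icc s t ⊆ Set.Icc 0 T := Set.Icc_subset_Icc hs htT
    have hsI : s ∈ Set.Icc s t := Set.left_mem_Icc.2 hst.le
    have hcont : ContinuousOn (fun τ => |φ (γ τ) - φ (γ s)|) (Set.Icc s t) :=
      ((hφ.comp (fun τ hτ => (hγ τ (hsub hτ)).continuousWithinAt.mono hsub)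
        (fun τ hτ => hγU τ (hsub hτ))).sub continuousOn_const).abs
    obtain ⟨τ₀, hτ₀, hmax⟩ := isCompact_Icc.exists_isMaxOn ⟨s, hsI⟩ hcont
    obtain ⟨F, hF⟩ : ∃ F, F = |φ (γ τ₀) - φ (γ s)| := ⟨_, rfl⟩
    have hF0 : 0 ≤ F := hF ▸ abs_nonneg _
    have hFle : ∀ τ ∈ Set.Icc s t, |φ (γ τ) - φ (γ s)| ≤ F := fun τ hτ => hF ▸ hmax hτ
    have hd : 0 ≤ t - s := by linarith
    have hY : ∀ τ ∈ Set.Icc s t, ∀ i, |(shiftQ B φ (γ s) (γ τ)).2 i| ≤ M * F * (t - s) := by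
      intro τ hτ i
      have hmv := (convex_Icc s t).norm_image_sub_le_of_norm_hasDerivWithin_le (C := M * F)
        (fun r hr => (hasDerivWithinAt_shiftQ_snd hskew
          (fst_integralCurve hγ (hsub hsI) (hsub hr)) (hUW (hγU s (hsub hsI)))
          (hγ r (hsub hr)) i).mono hsub)
        (fun r hr => by
          rw [norm_neg, norm_mul]
          exact mul_le_mul (hM i j 0) (hFle r hr) (abs_nonneg _) hM0) hsI hτ
      have h0 : (shiftQ B φ (γ s) (γ s)).2 i = 0 := by
        rw [shiftQ_snd hskew]
        have := dotProduct_mulVec_skew (hskew i) (γ s).1 (γ s).1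
        rw [sub_self, sub_self, zero_dotProduct]
        linarith
      rw [h0, sub_zero, Real.norm_eq_abs, Real.norm_eq_abs, abs_of_nonneg (sub_nonneg.2 hτ.1)]
        at hmv
      exact hmv.trans (mul_le_mul_of_nonneg_left (by linarith [hτ.2]) (by positivity))
    have hnorm_le : ∀ τ ∈ Set.Icc s t,
        hnorm (shiftQ B φ (γ s) (γ τ)) ≤ (t - s) + h * √(M * F * (t - s)) := by
      intro τ hτ
      refine add_le_add ?_ ?_
      · rw [shiftQ_fst, fst_integralCurve hγ (hsub hsI) (hsub hτ), add_sub_cancel_left]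
        have : ∑ k, |((τ - s) • (Pi.single j 1 : Fin m → ℝ)) k| = |τ - s| := by
          simp [Pi.single_apply, apply_ite abs]
        rw [this, abs_of_nonneg (sub_nonneg.2 hτ.1)]
        linarith [hτ.2]
      · calc ∑ i, √|(shiftQ B φ (γ s) (γ τ)).2 i| ≤ ∑ _i : Fin h, √(M * F * (t - s)) :=
              Finset.sum_le_sum fun i _ => Real.sqrt_le_sqrt (hY τ hτ i)
          _ = h * √(M * F * (t - s)) := by simp
    have hFC : F ≤ C * (t - s) := by
      rw [hC]
      refine le_of_le_add_mul_sqrt hd hM0 hF0 ?_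
      calc F ≤ L * hnorm (shiftQ B φ (γ s) (γ τ₀)) :=
            hF ▸ hLip' _ (hγU s (hsub hsI)) _ (hγU τ₀ (hsub hτ₀))
        _ ≤ _ := mul_le_mul_of_nonneg_left (hnorm_le τ₀ hτ₀) hL.le
    have htI : t ∈ Set.Icc s t := Set.right_mem_Icc.2 hst.le
    rw [abs_of_nonneg hd]
    constructor
    · have hsqrt : √(M * F * (t - s)) ≤ √(M * C) * (t - s) := by
        refine (Real.sqrt_le_sqrt (y := M * C * (t - s) ^ 2) ?_).trans_eq ?_
        · nlinarith [mul_le_mul_of_nonneg_left hFC (mul_nonneg hM0 hd)]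
        · rw [Real.sqrt_mul (by positivity), Real.sqrt_sq hd]
      have h₁ := hnorm_le t htI
      have h₂ := mul_le_mul_of_nonneg_left hsqrt (Nat.cast_nonneg (α := ℝ) h)
      have h₃ : 0 ≤ (L + C) * (t - s) := by positivity
      linarith
    · have h₃ : 0 ≤ (L + (1 + h * √(M * C))) * (t - s) := by positivity
      linarith [hFle t htI]
  · intro i w s t hst hU
    have h₁ := hLip' _ (hU s (Set.left_mem_Icc.2 hst.le)) _ (hU t (Set.right_mem_Icc.2 hst.le))
    have h₂ : hnorm (shiftQ B φ (w + s • eV m h i) (w + t • eV m h i)) = √(t - s) := by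
      have hw := fun i => dotProduct_mulVec_skew (hskew i) w.1 w.1
      have hx (r : ℝ) : (w + r • eV m h i).1 = w.1 := by simp [eV]
      have hsnd (i' : Fin h) : (shiftQ B φ (w + s • eV m h i) (w + t • eV m h i)).2 i'
          = if i' = i then t - s else 0 := by
        rw [shiftQ_snd hskew, hx, hx, sub_self, zero_dotProduct]
        have : w.1 ⬝ᵥ (B i').mulVec w.1 = 0 := by linarith [hw i']
        rw [this]
        by_cases hi : i' = i <;> simp [eV, hi]
      simp only [hnorm, shiftQ_fst, hsnd, hx, sub_self]
      simp [apply_ite abs, apply_ite Real.sqrt, abs_of_pos (sub_pos.2 hst)]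
    rw [h₂] at h₁
    have h₃ : 0 ≤ (C + (1 + h * √(M * C))) * √(t - s) := by positivity
    linarith

end Step2
end

section
/- Assume 0 ∈ U and φ(0) = 0, let L > 0 and let v ∈ U. Let N := m−1+h and suppose ζ_1,…,ζ_N is a concatenation of curves in U joining 0 to v, i.e. each ζ_r : [α_r,β_r] → U is continuous, ζ_1(α_1) = 0, ζ_{r+1}(α_{r+1}) = ζ_r(β_r) for r = 1,…,N−1, and ζ_N(β_N) = v, where for r = 1,…,m−1 the curve ζ_r is a C^1 integral curve of D^φ_{r+1}, and for r = m−1+i (i = 1,…,h) the curve ζ_r is an integral curve of ∂_{y_i} (an affine segment in the y_i-direction). Assume that for r = 1,…,m−1 the function t ↦ φ(ζ_r(t)) is Lipschitz with constant L on [α_r,β_r], and for r = m,…,N the function t ↦ φ(ζ_r(t)) is (1/2)-Hölder with constant L on [α_r,β_r]. Then there exists C > 0, depending only on L, m, h and the matrices B^(1),…,B^(h), such that for every r = 1,…,N and every t ∈ [α_r,β_r]: |φ(ζ_r(t))| ≤ C‖v‖ and ‖ζ_r(t)‖ ≤ C‖v‖. -/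
open MeasureTheory Filter Topology

namespace Step2

lemma abs_sub_le_of_chain {X : Type*} {N n : ℕ} (ζ : Fin N → ℝ → X) (α β : Fin N → ℝ)
    (hαβ : ∀ r, α r ≤ β r) (p : X)
    (h_start : ∀ r : Fin N, (r : ℕ) = 0 → ζ r (α r) = p)
    (h_next : ∀ r r' : Fin N, (r' : ℕ) = (r : ℕ) + 1 → ζ r' (α r') = ζ r (β r))
    (f : X → ℝ) {K : ℝ} (hK : 0 ≤ K)
    (h_incr : ∀ r : Fin N, (r : ℕ) < n → ∀ t ∈ Set.Icc (α r) (β r),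
      |f (ζ r t) - f (ζ r (α r))| ≤ K)
    (r : Fin N) (hr : (r : ℕ) < n) (t : ℝ) (ht : t ∈ Set.Icc (α r) (β r)) :
    |f (ζ r t) - f p| ≤ N * K := by
  have key : ∀ k : ℕ, ∀ r : Fin N, (r : ℕ) = k → (r : ℕ) < n → ∀ t ∈ Set.Icc (α r) (β r),
      |f (ζ r t) - f p| ≤ ((k : ℝ) + 1) * K := by
    intro k
    induction k with
    | zero =>
      intro r hr hn t ht
      rw [← h_start r hr]
      simpa using h_incr r hn t ht
    | succ k ih =>
      intro r hr hn t ht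
      have hlt := r.isLt
      let q : Fin N := ⟨k, by omega⟩
      have h1 := ih q rfl (show k < n by omega) (β q) ⟨hαβ q, le_rfl⟩
      have h2 := h_incr r hn t ht
      rw [h_next q r hr] at h2
      have h3 := abs_sub_le (f (ζ r t)) (f (ζ q (β q))) (f p)
      push_cast
      linarith
  refine (key r r rfl hr t ht).trans (mul_le_mul_of_nonneg_right ?_ hK)
  exact_mod_cast r.isLt

lemma le_of_monotoneOn_chain {X : Type*} {N n : ℕ} (ζ : Fin N → ℝ → X) (α β : Fin N → ℝ)
    (hαβ : ∀ r, α r ≤ β r)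
    (h_next : ∀ r r' : Fin N, (r' : ℕ) = (r : ℕ) + 1 → ζ r' (α r') = ζ r (β r))
    (f : X → ℝ)
    (h_mono : ∀ r : Fin N, n ≤ (r : ℕ) →
      MonotoneOn (fun t => f (ζ r t)) (Set.Icc (α r) (β r)))
    (r r' : Fin N) (hr : n ≤ (r : ℕ)) (hrr' : r ≤ r') :
    f (ζ r (α r)) ≤ f (ζ r' (α r')) ∧ f (ζ r (β r)) ≤ f (ζ r' (β r')) := by
  have key : ∀ k : ℕ, ∀ r' : Fin N, (r' : ℕ) = r + k →
      f (ζ r (α r)) ≤ f (ζ r' (α r')) ∧ f (ζ r (β r)) ≤ f (ζ r' (β r')) := by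
    intro k
    induction k with
    | zero =>
      intro r' h
      obtain rfl : r' = r := Fin.ext h
      exact ⟨le_rfl, le_rfl⟩
    | succ k ih =>
      intro r' h
      have hlt := r'.isLt
      let q : Fin N := ⟨r + k, by omega⟩
      obtain ⟨h1, h2⟩ := ih q rfl
      have hq := h_mono q (show n ≤ (r : ℕ) + k by omega) (Set.left_mem_Icc.2 (hαβ q))
        (Set.right_mem_Icc.2 (hαβ q)) (hαβ q)
      have hr' := h_mono r' (by omega) (Set.left_mem_Icc.2 (hαβ r'))
        (Set.right_mem_Icc.2 (hαβ r')) (hαβ r')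
      have hj := h_next q r' h
      simp only [hj] at hq hr' ⊢
      exact ⟨h1.trans hq, h2.trans hr'⟩
  have : (r : ℕ) ≤ r' := hrr'
  exact key (r' - r) r' (by omega)

lemma hasDerivWithinAt_fst_apply {m h : ℕ} {γ : ℝ → G m h} {w : G m h} {s : Set ℝ} {t : ℝ}
    (hγ : HasDerivWithinAt γ w s t) (j : Fin m) :
    HasDerivWithinAt (fun t => (γ t).1 j) (w.1 j) s t :=
  ((ContinuousLinearMap.proj (R := ℝ) (φ := fun _ : Fin m => ℝ) j).comp
    (ContinuousLinearMap.fst ℝ (Fin m → ℝ) (Fin h → ℝ))).hasFDerivAt.comp_hasDerivWithinAt t hγ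

lemma hasDerivWithinAt_snd_apply {m h : ℕ} {γ : ℝ → G m h} {w : G m h} {s : Set ℝ} {t : ℝ}
    (hγ : HasDerivWithinAt γ w s t) (i : Fin h) :
    HasDerivWithinAt (fun t => (γ t).2 i) (w.2 i) s t :=
  ((ContinuousLinearMap.proj (R := ℝ) (φ := fun _ : Fin h => ℝ) i).comp
    (ContinuousLinearMap.snd ℝ (Fin m → ℝ) (Fin h → ℝ))).hasFDerivAt.comp_hasDerivWithinAt t hγ

lemma sub_eq_mul_of_hasDerivWithinAt_const {f : ℝ → ℝ} {a b c : ℝ}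
    (hf : ∀ t ∈ Set.Icc a b, HasDerivWithinAt f c (Set.Icc a b) t)
    {s t : ℝ} (hs : s ∈ Set.Icc a b) (ht : t ∈ Set.Icc a b) :
    f t - f s = c * (t - s) := by
  have hd : ∀ u ∈ Set.Icc a b,
      HasDerivWithinAt (fun u => f u - c * u) (c - c * 1) (Set.Icc a b) u := fun u hu =>
    (hf u hu).sub ((hasDerivWithinAt_id u _).const_mul c)
  have h := (convex_Icc a b).norm_image_sub_le_of_norm_hasDerivWithin_le (C := 0) hd
    (by simp) hs ht
  simp only [zero_mul, norm_le_zero_iff] at h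
  linarith

lemma abs_fst_le_hnorm {m h : ℕ} (p : G m h) (j : Fin m) : |p.1 j| ≤ hnorm p := by
  have h1 := Finset.single_le_sum (f := fun j => |p.1 j|) (fun _ _ => abs_nonneg _)
    (Finset.mem_univ j)
  have h2 : 0 ≤ ∑ i, Real.sqrt |p.2 i| := Finset.sum_nonneg fun _ _ => Real.sqrt_nonneg _
  unfold hnorm
  linarith

lemma abs_snd_le_hnorm_sq {m h : ℕ} (p : G m h) (i : Fin h) : |p.2 i| ≤ hnorm p ^ 2 := by
  have h1 := Finset.single_le_sum (f := fun i => Real.sqrt |p.2 i|)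
    (fun _ _ => Real.sqrt_nonneg _) (Finset.mem_univ i)
  have h2 : 0 ≤ ∑ j, |p.1 j| := Finset.sum_nonneg fun _ _ => abs_nonneg _
  have h3 : Real.sqrt |p.2 i| ≤ hnorm p := by unfold hnorm; linarith
  exact (Real.sqrt_le_left (by unfold hnorm; linarith [Real.sqrt_nonneg |p.2 i|])).1 h3

lemma sum_abs_fst_le_hnorm {m h : ℕ} (p : G m h) : ∑ j, |p.1 j| ≤ hnorm p := by
  have h2 : 0 ≤ ∑ i, Real.sqrt |p.2 i| := Finset.sum_nonneg fun _ _ => Real.sqrt_nonneg _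
  unfold hnorm
  linarith

lemma hnorm_nonneg {m h : ℕ} (p : G m h) : 0 ≤ hnorm p :=
  (Finset.sum_nonneg fun _ _ => abs_nonneg _).trans (sum_abs_fst_le_hnorm p)

/-- The sum of the absolute values of all matrix entries. -/
noncomputable def entrySum {m h : ℕ} (B : Fin h → Matrix (Fin m) (Fin m) ℝ) : ℝ :=
  ∑ i, ∑ j, ∑ k, |B i j k|

lemma sum_abs_row_le_entrySum {m h : ℕ} (B : Fin h → Matrix (Fin m) (Fin m) ℝ)
    (i : Fin h) (j : Fin m) : ∑ k, |B i j k| ≤ entrySum B :=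
  (Finset.single_le_sum (f := fun j => ∑ k, |B i j k|)
    (fun _ _ => Finset.sum_nonneg fun _ _ => abs_nonneg _) (Finset.mem_univ j)).trans
  (Finset.single_le_sum (f := fun i => ∑ j, ∑ k, |B i j k|)
    (fun _ _ => Finset.sum_nonneg fun _ _ => Finset.sum_nonneg fun _ _ => abs_nonneg _)
    (Finset.mem_univ i))

lemma entrySum_nonneg {m h : ℕ} (B : Fin h → Matrix (Fin m) (Fin m) ℝ) : 0 ≤ entrySum B :=
  Finset.sum_nonneg fun _ _ => Finset.sum_nonneg fun _ _ => Finset.sum_nonneg fun _ _ =>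
    abs_nonneg _

lemma abs_Dvec_snd_le {m h : ℕ} [NeZero m] (B : Fin h → Matrix (Fin m) (Fin m) ℝ)
    (φ : G m h → ℝ) (j : Fin m) (w : G m h) (i : Fin h) {a b : ℝ}
    (hφ : |φ w| ≤ a) (hw : ∀ k, |w.1 k| ≤ b) :
    |(Dvec B φ j w).2 i| ≤ entrySum B * (a + b) := by
  have hb : 0 ≤ b := (abs_nonneg _).trans (hw 0)
  have hM := entrySum_nonneg B
  have hrow := sum_abs_row_le_entrySum B i j
  have h1 : |B i j 0 * φ w| ≤ entrySum B * a := by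
    rw [abs_mul]
    refine mul_le_mul ?_ hφ (abs_nonneg _) hM
    exact (Finset.single_le_sum (f := fun k => |B i j k|) (fun _ _ => abs_nonneg _)
      (Finset.mem_univ 0)).trans hrow
  have h2 : |∑ k ∈ Finset.univ.erase (0 : Fin m), w.1 k * B i j k| ≤ entrySum B * b := by
    calc |∑ k ∈ Finset.univ.erase (0 : Fin m), w.1 k * B i j k|
        ≤ ∑ k ∈ Finset.univ.erase (0 : Fin m), |w.1 k * B i j k| :=
          Finset.abs_sum_le_sum_abs _ _
      _ ≤ ∑ k, |w.1 k * B i j k| :=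
          Finset.sum_le_sum_of_subset_of_nonneg (Finset.erase_subset _ _)
            fun _ _ _ => abs_nonneg _
      _ ≤ ∑ k, |B i j k| * b := by
          refine Finset.sum_le_sum fun k _ => ?_
          rw [abs_mul, mul_comm]
          exact mul_le_mul_of_nonneg_left (hw k) (abs_nonneg _)
      _ = (∑ k, |B i j k|) * b := by rw [Finset.sum_mul]
      _ ≤ entrySum B * b := mul_le_mul_of_nonneg_right hrow hb
  have h3 : 0 ≤ entrySum B * b := mul_nonneg hM hb
  simp only [Dvec, abs_neg]
  refine (abs_add_le _ _).trans ?_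
  rw [abs_mul (1 / 2 : ℝ), abs_of_pos (by norm_num : (0 : ℝ) < 1 / 2)]
  linarith

/-- Given a concatenation `ζ_1,…,ζ_N` (`N = m-1+h`) of curves in `U` joining
`0` to `v`, where the first `m-1` curves are integral curves of `D^φ_2,…,D^φ_m` along which
`φ` is `L`-Lipschitz, and the last `h` are vertical segments along which `φ` is
`(1/2)`-Hölder with constant `L`, there is `C > 0`, depending only on `L, m, h, B`, with
`|φ(ζ_r(t))| ≤ C‖v‖` and `‖ζ_r(t)‖ ≤ C‖v‖` along the whole concatenation. -/
theorem statement7 (m h : ℕ) [NeZero m] (hm : 2 ≤ m) (hh : 1 ≤ h)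
    (B : Fin h → Matrix (Fin m) (Fin m) ℝ)
    (hskew : ∀ i, (B i).transpose = - B i) (hBli : LinearIndependent ℝ B)
    (L : ℝ) (hL : 0 < L) :
    ∃ C > (0:ℝ), ∀ (U : Set (G m h)) (φ : G m h → ℝ),
      U ⊆ Wset m h → RelOpen m h U → ContinuousOn φ U →
      (0 : G m h) ∈ U → φ 0 = 0 →
      ∀ v ∈ U, ∀ (ζ : Fin (m - 1 + h) → ℝ → G m h) (α β : Fin (m - 1 + h) → ℝ),
        (∀ r, α r ≤ β r) →
        -- the concatenation joins `0` to `v`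
        (∀ r : Fin (m - 1 + h), (r : ℕ) = 0 → ζ r (α r) = 0) →
        (∀ r r' : Fin (m - 1 + h), (r' : ℕ) = (r : ℕ) + 1 → ζ r' (α r') = ζ r (β r)) →
        (∀ r : Fin (m - 1 + h), (r : ℕ) = m - 1 + h - 1 → ζ r (β r) = v) →
        -- the curves lie in `U`
        (∀ r : Fin (m - 1 + h), ∀ t ∈ Set.Icc (α r) (β r), ζ r t ∈ U) →
        -- for `r = 1,…,m-1` (0-based `r < m-1`), `ζ_r` is an integral curve of `D^φ_{r+1}`
        (∀ r : Fin (m - 1 + h), ∀ j : Fin m, (j : ℕ) = (r : ℕ) + 1 →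
          ∀ t ∈ Set.Icc (α r) (β r),
            HasDerivWithinAt (ζ r) (Dvec B φ j (ζ r t)) (Set.Icc (α r) (β r)) t) →
        -- for `r = m-1+i`, `ζ_r` is an affine segment in the `y_i` direction
        (∀ r : Fin (m - 1 + h), ∀ i : Fin h, (r : ℕ) = m - 1 + (i : ℕ) →
          ∀ t ∈ Set.Icc (α r) (β r), ζ r t = ζ r (α r) + (t - α r) • eV m h i) →
        -- `φ` is `L`-Lipschitz along the horizontal curves
        (∀ r : Fin (m - 1 + h), (r : ℕ) < m - 1 →
          ∀ s ∈ Set.Icc (α r) (β r), ∀ t ∈ Set.Icc (α r) (β r),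
            |φ (ζ r t) - φ (ζ r s)| ≤ L * |t - s|) →
        -- `φ` is `(1/2)`-Hölder with constant `L` along the vertical segments
        (∀ r : Fin (m - 1 + h), m - 1 ≤ (r : ℕ) →
          ∀ s ∈ Set.Icc (α r) (β r), ∀ t ∈ Set.Icc (α r) (β r),
            |φ (ζ r t) - φ (ζ r s)| ≤ L * Real.sqrt |t - s|) →
        ∀ r : Fin (m - 1 + h), ∀ t ∈ Set.Icc (α r) (β r),
          |φ (ζ r t)| ≤ C * hnorm v ∧ hnorm (ζ r t) ≤ C * hnorm v := by
  set N := m - 1 + h with hN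
  have hM := entrySum_nonneg B
  obtain ⟨K, hKdef⟩ : ∃ K : ℝ, K = N * (entrySum B * (N * L + 1)) := ⟨_, rfl⟩
  have hK : 0 ≤ K := by rw [hKdef]; positivity
  obtain ⟨S, hSdef⟩ : ∃ S : ℝ, S = Real.sqrt (K + 1) := ⟨_, rfl⟩
  have hS1 : 1 ≤ S := by rw [hSdef]; exact Real.one_le_sqrt.2 (by linarith)
  have hNLS : 0 ≤ N * (L * S) := by positivity
  have hhS : 0 ≤ h * S := by positivity
  refine ⟨N * (L * S) + 1 + h * S, by linarith, ?_⟩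
  intro U φ _ _ _ _ hφ0 v _ ζ α β hαβ h_start h_next h_end _ h_hor h_vert h_lip h_hold
  obtain ⟨V, hVdef⟩ : ∃ V : ℝ, V = hnorm v := ⟨_, rfl⟩
  rw [← hVdef]
  have hV : 0 ≤ V := hVdef ▸ hnorm_nonneg v
  have hleft : ∀ r, α r ∈ Set.Icc (α r) (β r) := fun r => Set.left_mem_Icc.2 (hαβ r)
  have hright : ∀ r, β r ∈ Set.Icc (α r) (β r) := fun r => Set.right_mem_Icc.2 (hαβ r)
  let first : Fin N := ⟨0, by omega⟩
  let last : Fin N := ⟨N - 1, by omega⟩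
  have h_first : ζ first (α first) = 0 := h_start first rfl
  have h_last : ζ last (β last) = v := h_end last rfl
  have hx_hor : ∀ r : Fin N, ∀ j : Fin m, (j : ℕ) = r + 1 → ∀ j' : Fin m,
      ∀ s ∈ Set.Icc (α r) (β r), ∀ t ∈ Set.Icc (α r) (β r),
      (ζ r t).1 j' - (ζ r s).1 j' = (if j' = j then 1 else 0) * (t - s) :=
    fun r j hj j' s hs t ht => sub_eq_mul_of_hasDerivWithinAt_const
      (fun u hu => hasDerivWithinAt_fst_apply (h_hor r j hj u hu) j') hs ht
  have hvert_sub : ∀ r : Fin N, ∀ i : Fin h, (r : ℕ) = m - 1 + (i : ℕ) →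
      ∀ s ∈ Set.Icc (α r) (β r), ∀ t ∈ Set.Icc (α r) (β r),
      ζ r t - ζ r s = (t - s) • eV m h i := by
    intro r i hi s hs t ht
    rw [h_vert r i hi t ht, h_vert r i hi s hs]
    module
  have hcases : ∀ r : Fin N, (∃ j : Fin m, (r : ℕ) < m - 1 ∧ (j : ℕ) = r + 1) ∨
      ∃ i : Fin h, (r : ℕ) = m - 1 + (i : ℕ) := by
    intro r
    have := r.isLt
    by_cases hr : (r : ℕ) < m - 1
    · exact Or.inl ⟨⟨r + 1, by omega⟩, hr, rfl⟩
    · exact Or.inr ⟨⟨r - (m - 1), by omega⟩, show (r : ℕ) = m - 1 + (r - (m - 1)) by omega⟩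
  have hx_mono : ∀ j : Fin m, ∀ r : Fin N, 0 ≤ (r : ℕ) →
      MonotoneOn (fun t => (ζ r t).1 j) (Set.Icc (α r) (β r)) := by
    intro j r _ s hs t ht hst
    rcases hcases r with ⟨j', _, hj'⟩ | ⟨i, hi⟩
    · have h1 := hx_hor r j' hj' j s hs t ht
      have : 0 ≤ (if j = j' then (1 : ℝ) else 0) * (t - s) :=
        mul_nonneg (by split_ifs <;> norm_num) (by linarith)
      change (ζ r s).1 j ≤ (ζ r t).1 j
      linarith
    · have h1 := congrArg (fun p : G m h => p.1 j) (hvert_sub r i hi s hs t ht)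
      simp only [eV, Prod.fst_sub, Pi.sub_apply, Prod.smul_fst, smul_zero, Pi.zero_apply] at h1
      change (ζ r s).1 j ≤ (ζ r t).1 j
      linarith
  have hx_bounds : ∀ (j : Fin m) (r : Fin N), ∀ t ∈ Set.Icc (α r) (β r),
      0 ≤ (ζ r t).1 j ∧ (ζ r t).1 j ≤ v.1 j := by
    intro j r t ht
    have h1 := (le_of_monotoneOn_chain ζ α β hαβ h_next (fun p : G m h => p.1 j) (hx_mono j)
      first r (Nat.zero_le _) (Fin.le_def.2 (Nat.zero_le _))).1
    have h2 := (le_of_monotoneOn_chain ζ α β hαβ h_next (fun p : G m h => p.1 j) (hx_mono j)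
      r last (Nat.zero_le _) (Fin.le_def.2 (show (r : ℕ) ≤ N - 1 by omega))).2
    rw [h_first] at h1
    rw [h_last] at h2
    exact ⟨h1.trans (hx_mono j r (Nat.zero_le _) (hleft r) ht ht.1),
      (hx_mono j r (Nat.zero_le _) ht (hright r) ht.2).trans h2⟩
  have hx_abs : ∀ (r : Fin N), ∀ t ∈ Set.Icc (α r) (β r), ∀ j, |(ζ r t).1 j| ≤ |v.1 j| := by
    intro r t ht j
    obtain ⟨h1, h2⟩ := hx_bounds j r t ht
    exact abs_le_abs_of_nonneg h1 h2
  have hxV : ∀ (r : Fin N), ∀ t ∈ Set.Icc (α r) (β r), ∀ j, |(ζ r t).1 j| ≤ V :=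
    fun r t ht j => (hx_abs r t ht j).trans (hVdef ▸ abs_fst_le_hnorm v j)
  have hlen_hor : ∀ r : Fin N, (r : ℕ) < m - 1 → β r - α r ≤ V := by
    intro r hr
    let j : Fin m := ⟨r + 1, by omega⟩
    have h1 := hx_hor r j rfl j _ (hleft r) _ (hright r)
    rw [if_pos rfl, one_mul] at h1
    have h2 := (hx_bounds j r _ (hleft r)).1
    have h3 := (le_abs_self _).trans (hxV r _ (hright r) j)
    linarith
  have hφ_incr_hor : ∀ r : Fin N, (r : ℕ) < m - 1 → ∀ t ∈ Set.Icc (α r) (β r),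
      |φ (ζ r t) - φ (ζ r (α r))| ≤ L * V := by
    intro r hr t ht
    refine (h_lip r hr _ (hleft r) t ht).trans (mul_le_mul_of_nonneg_left ?_ hL.le)
    rw [abs_of_nonneg (by linarith [ht.1])]
    linarith [ht.2, hlen_hor r hr]
  have hφ_hor : ∀ r : Fin N, (r : ℕ) < m - 1 → ∀ t ∈ Set.Icc (α r) (β r),
      |φ (ζ r t)| ≤ N * (L * V) := by
    intro r hr t ht
    have := abs_sub_le_of_chain ζ α β hαβ 0 h_start h_next φ (by positivity) hφ_incr_hor r hr t ht
    rwa [hφ0, sub_zero] at this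
  have hy_incr_hor : ∀ i : Fin h, ∀ r : Fin N, (r : ℕ) < m - 1 →
      ∀ t ∈ Set.Icc (α r) (β r),
      |(ζ r t).2 i - (ζ r (α r)).2 i| ≤ entrySum B * (N * (L * V) + V) * V := by
    intro i r hr t ht
    let j : Fin m := ⟨r + 1, by omega⟩
    have h1 := (convex_Icc (α r) (β r)).norm_image_sub_le_of_norm_hasDerivWithin_le
      (fun u hu => hasDerivWithinAt_snd_apply (h_hor r j rfl u hu) i)
      (fun u hu => abs_Dvec_snd_le B φ j (ζ r u) i (hφ_hor r hr u hu) (hxV r u hu))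
      (hleft r) ht
    refine h1.trans (mul_le_mul_of_nonneg_left ?_ (by positivity))
    rw [Real.norm_of_nonneg (by linarith [ht.1])]
    linarith [ht.2, hlen_hor r hr]
  have hy_hor : ∀ i : Fin h, ∀ r : Fin N, (r : ℕ) < m - 1 → ∀ t ∈ Set.Icc (α r) (β r),
      |(ζ r t).2 i| ≤ K * V ^ 2 := by
    intro i r hr t ht
    have := abs_sub_le_of_chain ζ α β hαβ 0 h_start h_next (fun p : G m h => p.2 i)
      (by positivity) (hy_incr_hor i) r hr t ht
    simp only [Prod.snd_zero, Pi.zero_apply, sub_zero] at this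
    refine this.trans (le_of_eq ?_)
    rw [hKdef]
    ring
  have hy_vert_sub : ∀ r : Fin N, ∀ i : Fin h, (r : ℕ) = m - 1 + (i : ℕ) → ∀ i' : Fin h,
      ∀ s ∈ Set.Icc (α r) (β r), ∀ t ∈ Set.Icc (α r) (β r),
      (ζ r t).2 i' - (ζ r s).2 i' = (t - s) * (if i' = i then 1 else 0) :=
    fun r i hi i' s hs t ht =>
      congrArg (fun p : G m h => p.2 i') (hvert_sub r i hi s hs t ht)
  have hy_mono : ∀ i' : Fin h, ∀ r : Fin N, m - 1 ≤ (r : ℕ) →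
      MonotoneOn (fun t => (ζ r t).2 i') (Set.Icc (α r) (β r)) := by
    intro i' r hr s hs t ht hst
    rcases hcases r with ⟨j, hj, _⟩ | ⟨i, hi⟩
    · omega
    · have h1 := hy_vert_sub r i hi i' s hs t ht
      have : 0 ≤ (t - s) * (if i' = i then (1 : ℝ) else 0) :=
        mul_nonneg (by linarith) (by split_ifs <;> norm_num)
      change (ζ r s).2 i' ≤ (ζ r t).2 i'
      linarith
  have hy_vert : ∀ i : Fin h, ∀ r : Fin N, m - 1 ≤ (r : ℕ) → ∀ t ∈ Set.Icc (α r) (β r),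
      -(K * V ^ 2) ≤ (ζ r t).2 i ∧ (ζ r t).2 i ≤ V ^ 2 := by
    intro i r hr t ht
    let q : Fin N := ⟨m - 1, by omega⟩
    let q' : Fin N := ⟨m - 2, by omega⟩
    have h1 := (le_of_monotoneOn_chain ζ α β hαβ h_next (fun p : G m h => p.2 i) (hy_mono i)
      q r le_rfl (Fin.le_def.2 hr)).1
    have h2 := (le_of_monotoneOn_chain ζ α β hαβ h_next (fun p : G m h => p.2 i) (hy_mono i)
      r last hr (Fin.le_def.2 (show (r : ℕ) ≤ N - 1 by omega))).2
    have hqq' : ζ q (α q) = ζ q' (β q') := h_next q' q (show m - 1 = m - 2 + 1 by omega)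
    have h3 := neg_le_of_abs_le (hy_hor i q' (show m - 2 < m - 1 by omega) _ (hright q'))
    simp only [hqq'] at h1
    simp only [h_last] at h2
    have h4 : v.2 i ≤ V ^ 2 := (le_abs_self _).trans (hVdef ▸ abs_snd_le_hnorm_sq v i)
    exact ⟨h3.trans (h1.trans (hy_mono i r hr (hleft r) ht ht.1)),
      ((hy_mono i r hr ht (hright r) ht.2).trans h2).trans h4⟩
  have hSV : Real.sqrt ((K + 1) * V ^ 2) = S * V := by
    rw [Real.sqrt_mul (by linarith), Real.sqrt_sq hV, hSdef]
  have hKV : 0 ≤ K * V ^ 2 := by positivity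
  have hy_abs : ∀ i : Fin h, ∀ r : Fin N, ∀ t ∈ Set.Icc (α r) (β r),
      |(ζ r t).2 i| ≤ (K + 1) * V ^ 2 := by
    intro i r t ht
    rcases lt_or_ge (r : ℕ) (m - 1) with hr | hr
    · linarith [hy_hor i r hr t ht, sq_nonneg V]
    · obtain ⟨h1, h2⟩ := hy_vert i r hr t ht
      exact abs_le.2 ⟨by linarith [sq_nonneg V], by linarith⟩
  have hφ_incr : ∀ r : Fin N, (r : ℕ) < N → ∀ t ∈ Set.Icc (α r) (β r),
      |φ (ζ r t) - φ (ζ r (α r))| ≤ L * (S * V) := by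
    intro r _ t ht
    rcases hcases r with ⟨j, hr, _⟩ | ⟨i, hi⟩
    · refine (hφ_incr_hor r hr t ht).trans (mul_le_mul_of_nonneg_left ?_ hL.le)
      exact le_mul_of_one_le_left hV hS1
    · have hr : m - 1 ≤ (r : ℕ) := by omega
      refine (h_hold r hr _ (hleft r) t ht).trans (mul_le_mul_of_nonneg_left ?_ hL.le)
      rw [← hSV]
      refine Real.sqrt_le_sqrt ?_
      have h1 := hy_vert_sub r i hi i _ (hleft r) t ht
      rw [if_pos rfl, mul_one] at h1
      rw [abs_of_nonneg (by linarith [ht.1])]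
      linarith [(hy_vert i r hr _ (hleft r)).1, (hy_vert i r hr t ht).2]
  intro r t ht
  constructor
  · have h1 := abs_sub_le_of_chain ζ α β hαβ 0 h_start h_next φ (by positivity) hφ_incr
      r r.isLt t ht
    rw [hφ0, sub_zero] at h1
    have : 0 ≤ (1 + h * S) * V := by positivity
    linarith
  · have h1 : ∑ j, |(ζ r t).1 j| ≤ V :=
      (Finset.sum_le_sum fun j _ => hx_abs r t ht j).trans (hVdef ▸ sum_abs_fst_le_hnorm v)
    have h2 : ∑ i, Real.sqrt |(ζ r t).2 i| ≤ h * (S * V) := by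
      have := Finset.sum_le_card_nsmul Finset.univ (fun i => Real.sqrt |(ζ r t).2 i|) (S * V)
        fun i _ => hSV ▸ Real.sqrt_le_sqrt (hy_abs i r t ht)
      simpa using this
    have : 0 ≤ N * (L * S) * V := by positivity
    unfold hnorm
    linarith

end Step2
end
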